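/- Let r, s ∈ (0,∞) with s > r, θ > 0, μ ∈ ℝ^d, and let X be an ℝ^d-valued random variable with distribution P = f·λ_d such that E|X|^{r+η} < ∞ for some η > 0 and such that P_{θ,μ} is absolutely continuous with respect to P. Let (α_n)_{n≥1} be an L^r(P)-optimal sequence of quantizers and suppose that the maximal function satisfies ψ_b^{s/(d+r)} ∈ L^1(P_{θ,μ}) for some b ∈ (0,1/2). Then ∫_{ℝ^d} f_{θ,μ} · f^{−s/(d+r)} dλ_d < ∞ and limsup_{n→∞} n^{s/d} ∫ d(x, α_n^{θ,μ})^s dP(x) < ∞, i.e. the sequence (α_n^{θ,μ})_{n≥1} is L^s(P)-rate-optimal. -/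

import Mathlib

open MeasureTheory ENNReal Filter Set Metric Topology
open scoped Classical

noncomputable section

/-- Distance from a point `x` to a finite codebook `α`. -/
def qdist {d : ℕ} (x : EuclideanSpace ℝ (Fin d)) (α : Finset (EuclideanSpace ℝ (Fin d))) : ℝ :=
  Metric.infDist x (α : Set (EuclideanSpace ℝ (Fin d)))

/-- The `r`-th power `L^r` quantization error `∫ d(x,α)^r dP` of a codebook `α`. -/
def qerr {d : ℕ} (P : Measure (EuclideanSpace ℝ (Fin d))) (r : ℝ)
    (α : Finset (EuclideanSpace ℝ (Fin d))) : ℝ≥0∞ :=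
  ∫⁻ x, ENNReal.ofReal (qdist x α) ^ r ∂P

/-- The optimal `n`-level `L^r` quantization error `e_{n,r}(P)`. -/
def enr {d : ℕ} (P : Measure (EuclideanSpace ℝ (Fin d))) (r : ℝ) (n : ℕ) : ℝ≥0∞ :=
  ⨅ (α : Finset (EuclideanSpace ℝ (Fin d))) (_ : α.Nonempty) (_ : α.card ≤ n),
    qerr P r α ^ (1 / r)

/-- The uniform distribution on the unit cube `[0,1]^d`. -/
def unifCube (d : ℕ) : Measure (EuclideanSpace ℝ (Fin d)) :=
  volume.restrict {x | ∀ i, x i ∈ Icc (0 : ℝ) 1}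

/-- The constant `J_{r,d} = inf_{n ≥ 1} n^{r/d} e_{n,r}(U([0,1]^d))^r`. -/
def Jrd (r : ℝ) (d : ℕ) : ℝ≥0∞ :=
  ⨅ (n : ℕ) (_ : 1 ≤ n), (n : ℝ≥0∞) ^ (r / (d : ℝ)) * enr (unifCube d) r n ^ r

/-- Zador's constant `Q_r(P)` for a measure whose a.c. part has density `f`. -/
def Qr {d : ℕ} (f : EuclideanSpace ℝ (Fin d) → ℝ) (r : ℝ) : ℝ≥0∞ :=
  Jrd r d * (∫⁻ x, ENNReal.ofReal (f x) ^ ((d : ℝ) / ((d : ℝ) + r))) ^ (((d : ℝ) + r) / (d : ℝ))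

/-- The dilated/contracted codebook `α^{θ,μ} = μ + θ(α - μ)`. -/
def dilate {d : ℕ} (α : Finset (EuclideanSpace ℝ (Fin d))) (θ : ℝ)
    (μ : EuclideanSpace ℝ (Fin d)) : Finset (EuclideanSpace ℝ (Fin d)) :=
  α.image fun a => μ + θ • (a - μ)

/-- `f_{θ,μ}(x) = f(μ + θ(x-μ))`. -/
def fdil {d : ℕ} (f : EuclideanSpace ℝ (Fin d) → ℝ) (θ : ℝ)
    (μ x : EuclideanSpace ℝ (Fin d)) : ℝ :=
  f (μ + θ • (x - μ))

/-- The image measure `P_{θ,μ}` of `P` under `x ↦ (x-μ)/θ + μ`. -/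
def Pdil {d : ℕ} (P : Measure (EuclideanSpace ℝ (Fin d))) (θ : ℝ)
    (μ : EuclideanSpace ℝ (Fin d)) : Measure (EuclideanSpace ℝ (Fin d)) :=
  Measure.map (fun x => μ + θ⁻¹ • (x - μ)) P

/-- `(θ,μ)` is `P`-admissible for `P = f·λ_d`:
`{f>0} ⊆ μ(1-θ) + θ{f>0}` up to a `λ_d`-null set.  (Note that
`x ∈ μ(1-θ) + θ{f>0}` iff `f((x-μ)/θ + μ) > 0`.) -/
def Admissible {d : ℕ} (f : EuclideanSpace ℝ (Fin d) → ℝ) (θ : ℝ)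
    (μ : EuclideanSpace ℝ (Fin d)) : Prop :=
  ∀ᵐ x ∂(volume : Measure (EuclideanSpace ℝ (Fin d))),
    0 < f x → 0 < f (μ + θ⁻¹ • (x - μ))

/-- The maximal function `ψ_b` attached to `P` and the sequence of codebooks `α`. -/
def maxFun {d : ℕ} (P : Measure (EuclideanSpace ℝ (Fin d)))
    (α : ℕ → Finset (EuclideanSpace ℝ (Fin d))) (b : ℝ)
    (x : EuclideanSpace ℝ (Fin d)) : ℝ≥0∞ :=
  ⨆ (n : ℕ) (_ : 1 ≤ n),
    volume (Metric.ball x (b * qdist x (α n))) / P (Metric.ball x (b * qdist x (α n)))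

/-- An `L^r(P)`-optimal sequence of `n`-quantizers. -/
def OptimalSeq {d : ℕ} (P : Measure (EuclideanSpace ℝ (Fin d))) (r : ℝ)
    (α : ℕ → Finset (EuclideanSpace ℝ (Fin d))) : Prop :=
  ∀ n, 1 ≤ n → (α n).Nonempty ∧ (α n).card ≤ n ∧ qerr P r (α n) = enr P r n ^ r

/-- An asymptotically `L^r(P)`-optimal sequence of quantizers,
for `P` whose a.c. part has density `f`. -/
def AsympOptimalSeq {d : ℕ} (P : Measure (EuclideanSpace ℝ (Fin d)))
    (f : EuclideanSpace ℝ (Fin d) → ℝ) (r : ℝ)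
    (α : ℕ → Finset (EuclideanSpace ℝ (Fin d))) : Prop :=
  (∀ n, 1 ≤ n → (α n).Nonempty ∧ (α n).card ≤ n) ∧
  Tendsto (fun n : ℕ => (n : ℝ≥0∞) ^ (r / (d : ℝ)) * qerr P r (α n)) atTop (𝓝 (Qr f r))

/-- `L^s(P)`-rate-optimality of a sequence of codebooks. -/
def RateOptimal {d : ℕ} (P : Measure (EuclideanSpace ℝ (Fin d))) (s : ℝ)
    (β : ℕ → Finset (EuclideanSpace ℝ (Fin d))) : Prop :=
  limsup (fun n : ℕ => (n : ℝ≥0∞) ^ (s / (d : ℝ)) * qerr P s (β n)) atTop < ⊤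

/-- The support of a measure. -/
def msupp {d : ℕ} (P : Measure (EuclideanSpace ℝ (Fin d))) : Set (EuclideanSpace ℝ (Fin d)) :=
  {x | ∀ ε > 0, 0 < P (Metric.ball x ε)}

/-- Hypothesis (H1): for every `M > 0`,
`sup { f(μ+θ(z-μ))/f(z) : z ∈ B(0,M), f(z) > 0 } < ∞`. -/
def H1 {d : ℕ} (f : EuclideanSpace ℝ (Fin d) → ℝ) (θ : ℝ)
    (μ : EuclideanSpace ℝ (Fin d)) : Prop :=
  ∀ M > (0 : ℝ), ∃ C : ℝ, ∀ z ∈ Metric.ball (0 : EuclideanSpace ℝ (Fin d)) M,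
    0 < f z → f (μ + θ • (z - μ)) / f z ≤ C

/-- Hypothesis (H2). -/
def H2 {d : ℕ} (P : Measure (EuclideanSpace ℝ (Fin d))) (θ : ℝ)
    (μ : EuclideanSpace ℝ (Fin d)) (s r : ℝ) : Prop :=
  ∃ b ∈ Ioo (0 : ℝ) (1 / 2), ∃ M > (0 : ℝ),
    (∫⁻ x in {x : EuclideanSpace ℝ (Fin d) | M < ‖x‖},
      (⨆ t ∈ Ioc (0 : ℝ) (2 * b * ‖x‖),
        volume (Metric.ball x t) / P (Metric.ball x t)) ^ (s / ((d : ℝ) + r))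
      ∂(Pdil P θ μ)) < ⊤

/-- Hypothesis (H3): `λ_d(· ∩ supp P) ≪ P` and `supp P` is a finite union of
closed convex sets. -/
def H3 {d : ℕ} (P : Measure (EuclideanSpace ℝ (Fin d))) : Prop :=
  volume.restrict (msupp P) ≪ P ∧
  ∃ (k : ℕ) (C : Fin k → Set (EuclideanSpace ℝ (Fin d))),
    (∀ i, IsClosed (C i) ∧ Convex ℝ (C i)) ∧ msupp P = ⋃ i, C i

section Geometry

variable {d : ℕ}

/-- The volume of the unit ball, as a real number. -/
def ballVol (d : ℕ) : ℝ :=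
  (volume (ball (0 : EuclideanSpace ℝ (Fin d)) 1)).toReal

lemma ballVol_pos (d : ℕ) : 0 < ballVol d :=
  ENNReal.toReal_pos (measure_ball_pos _ _ one_pos).ne' measure_ball_lt_top.ne

lemma volume_ball_eq (x : EuclideanSpace ℝ (Fin d)) {t : ℝ} (ht : 0 < t) :
    volume (ball x t) = ENNReal.ofReal (t ^ d * ballVol d) := by
  rw [Measure.addHaar_ball_of_pos _ _ ht, finrank_euclideanSpace_fin,
    ENNReal.ofReal_mul (by positivity), ballVol, ENNReal.ofReal_toReal measure_ball_lt_top.ne]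

lemma sum_volume_ball_le {μ : Measure (EuclideanSpace ℝ (Fin d))}
    (S : Finset (EuclideanSpace ℝ (Fin d))) (ρ : EuclideanSpace ℝ (Fin d) → ℝ)
    (hsep : ∀ a ∈ S, ∀ a' ∈ S, a ≠ a' → ρ a + ρ a' ≤ dist a a')
    (g : EuclideanSpace ℝ (Fin d) → ℝ≥0∞) :
    ∑ a ∈ S, ∫⁻ x in ball a (ρ a), g x ∂μ ≤ ∫⁻ x, g x ∂μ := by
  rw [← lintegral_biUnion_finset]
  · exact setLIntegral_le_lintegral _ _
  · intro a ha a' ha' hne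
    exact ball_disjoint_ball (hsep a ha a' ha' hne)
  · intro a _
    exact measurableSet_ball

lemma card_mul_pow_le_of_separated {β : ℝ} (hd : 1 ≤ d) (hβ : 0 < β) :
    ∃ A : ℝ, 0 < A ∧ ∀ h : ℝ, 0 < h → ∀ S : Finset (EuclideanSpace ℝ (Fin d)),
      (∀ a ∈ S, h * (1 + ‖a‖) ^ (1 + β) ≤ (1 + ‖a‖) / 2) →
      (∀ a ∈ S, ∀ a' ∈ S, a ≠ a' →
        h * (1 + ‖a‖) ^ (1 + β) ≤ dist a a' ∧ h * (1 + ‖a'‖) ^ (1 + β) ≤ dist a a') →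
      S.card * h ^ d ≤ A := by
  have hd' : (0 : ℝ) < d := by exact_mod_cast hd
  set q : ℝ := (1 + β) * d with hq
  have hI : ∫⁻ x : EuclideanSpace ℝ (Fin d), ENNReal.ofReal ((1 + ‖x‖) ^ (-q)) < ⊤ := by
    apply finite_integral_one_add_norm
    rw [finrank_euclideanSpace_fin]
    nlinarith
  set I := ∫⁻ x : EuclideanSpace ℝ (Fin d), ENNReal.ofReal ((1 + ‖x‖) ^ (-q)) with hIdef
  set c : ℝ := 2 ^ (-q) * (2⁻¹) ^ d * ballVol d with hc
  have hcpos : 0 < c := by have := ballVol_pos d; positivity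
  refine ⟨I.toReal / c + 1, by positivity, fun h hh S hS hsep => ?_⟩
  have key : ∀ a ∈ S, ENNReal.ofReal (c * h ^ d) ≤
      ∫⁻ x in ball a (h * (1 + ‖a‖) ^ (1 + β) / 2), ENNReal.ofReal ((1 + ‖x‖) ^ (-q)) := by
    intro a ha
    have hna : 0 < 1 + ‖a‖ := by positivity
    have hw : 0 < (1 + ‖a‖) ^ (1 + β) := by positivity
    have hR : 0 < h * (1 + ‖a‖) ^ (1 + β) / 2 := by positivity
    calc ENNReal.ofReal (c * h ^ d)
        = ENNReal.ofReal ((2 * (1 + ‖a‖)) ^ (-q)) *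
            volume (ball a (h * (1 + ‖a‖) ^ (1 + β) / 2)) := by
          rw [volume_ball_eq _ hR, ← ENNReal.ofReal_mul (by positivity)]
          congr 1
          have e1 : ((1 + ‖a‖) ^ (1 + β)) ^ d = (1 + ‖a‖) ^ q := by
            rw [hq, Real.rpow_mul hna.le, Real.rpow_natCast]
          have e2 : (1 + ‖a‖) ^ (-q) * (1 + ‖a‖) ^ q = 1 := by
            rw [← Real.rpow_add hna]; simp
          rw [Real.mul_rpow (by norm_num) hna.le, div_eq_mul_inv, mul_pow, mul_pow, e1, hc]
          linear_combination (-(2 ^ (-q) * (2⁻¹) ^ d * ballVol d * h ^ d)) * e2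
      _ = ∫⁻ x in ball a (h * (1 + ‖a‖) ^ (1 + β) / 2),
            ENNReal.ofReal ((2 * (1 + ‖a‖)) ^ (-q)) := by
          rw [setLIntegral_const]
      _ ≤ _ := by
          refine setLIntegral_mono' measurableSet_ball fun x hx => ?_
          apply ENNReal.ofReal_le_ofReal
          apply Real.rpow_le_rpow_of_nonpos (by positivity)
          · have h1 := hS a ha
            have h2 : ‖x - a‖ < h * (1 + ‖a‖) ^ (1 + β) / 2 := by
              simpa [dist_eq_norm] using hx
            have h3 : ‖x‖ ≤ ‖a‖ + ‖x - a‖ := by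
              simpa using norm_add_le a (x - a)
            linarith
          · have : 0 < q := by positivity
            linarith
  have hsum := sum_volume_ball_le (μ := volume) S (fun a => h * (1 + ‖a‖) ^ (1 + β) / 2)
    (fun a ha a' ha' hne => by
      have := hsep a ha a' ha' hne
      linarith) (fun x => ENNReal.ofReal ((1 + ‖x‖) ^ (-q)))
  have h1 : (S.card : ℝ≥0∞) * ENNReal.ofReal (c * h ^ d) ≤ I := by
    rw [← nsmul_eq_mul]
    exact (Finset.card_nsmul_le_sum _ _ _ key).trans hsum
  have h2 : S.card * (c * h ^ d) ≤ I.toReal := by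
    have := ENNReal.toReal_mono hI.ne h1
    rwa [ENNReal.toReal_mul, ENNReal.toReal_natCast, ENNReal.toReal_ofReal (by positivity)] at this
  have h3 : S.card * h ^ d ≤ I.toReal / c := by
    rw [le_div_iff₀ hcpos]; linarith
  linarith

lemma exists_weighted_net {β : ℝ} (hd : 1 ≤ d) (hβ : 0 < β) :
    ∃ A : ℝ, 0 < A ∧ ∀ h : ℝ, 0 < h → ∃ S : Finset (EuclideanSpace ℝ (Fin d)),
      S.Nonempty ∧ S.card * h ^ d ≤ A + h ^ d ∧
      ∀ x, qdist x S ≤ 2 ^ (1 + β) * (h * (1 + ‖x‖) ^ (1 + β)) := by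
  obtain ⟨A, hA, hcard⟩ := card_mul_pow_le_of_separated (d := d) hd hβ
  refine ⟨A, hA, fun h hh => ?_⟩
  let good : Finset (EuclideanSpace ℝ (Fin d)) → Prop := fun S =>
    (∀ a ∈ S, h * (1 + ‖a‖) ^ (1 + β) ≤ (1 + ‖a‖) / 2) ∧
      (∀ a ∈ S, ∀ a' ∈ S, a ≠ a' →
        h * (1 + ‖a‖) ^ (1 + β) ≤ dist a a' ∧ h * (1 + ‖a'‖) ^ (1 + β) ≤ dist a a')
  obtain ⟨S, hS, hmax⟩ : ∃ S, good S ∧ ∀ S', good S' → S'.card ≤ S.card := by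
    have hbdd : ∀ S, good S → S.card ≤ ⌊A / h ^ d⌋₊ := fun S hS => by
      apply Nat.le_floor
      rw [le_div_iff₀ (by positivity)]
      exact hcard h hh S hS.1 hS.2
    obtain ⟨S, hS, hk⟩ := Nat.findGreatest_spec (P := fun k => ∃ S, good S ∧ S.card = k)
      (n := ⌊A / h ^ d⌋₊) (Nat.zero_le _) ⟨∅, ⟨by simp, by simp⟩, by simp⟩
    refine ⟨S, hS, fun S' hS' => ?_⟩
    rw [hk]
    exact Nat.le_findGreatest (hbdd S' hS') ⟨S', hS', rfl⟩
  have h2 : (2 : ℝ) ≤ 2 ^ (1 + β) := by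
    conv_lhs => rw [← Real.rpow_one 2]
    exact Real.rpow_le_rpow_of_exponent_le (by norm_num) (by linarith)
  refine ⟨insert 0 S, by simp, ?_, fun x => ?_⟩
  · have h1 := hcard h hh S hS.1 hS.2
    have h3 : ((insert 0 S).card : ℝ) ≤ S.card + 1 := by
      exact_mod_cast Finset.card_insert_le _ _
    have : ((insert 0 S).card : ℝ) * h ^ d ≤ (S.card + 1) * h ^ d := by gcongr
    linarith
  have hw : 0 < h * (1 + ‖x‖) ^ (1 + β) := by positivity
  have hle : ∀ a ∈ insert 0 S, qdist x (insert 0 S) ≤ dist x a := fun a ha =>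
    infDist_le_dist_of_mem (by exact_mod_cast ha)
  by_cases hx : h * (1 + ‖x‖) ^ (1 + β) ≤ (1 + ‖x‖) / 2
  · suffices ∃ a ∈ S, dist x a ≤ 2 ^ (1 + β) * (h * (1 + ‖x‖) ^ (1 + β)) by
      obtain ⟨a, ha, hxa⟩ := this
      exact (hle a (by simp [ha])).trans hxa
    by_contra! hcon
    have hxS : x ∉ S := fun hxS => by
      have := hcon x hxS
      rw [dist_self] at this
      exact absurd this (by push Not; positivity)
    have hfar : ∀ a ∈ S, h * (1 + ‖a‖) ^ (1 + β) ≤ dist x a ∧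
        h * (1 + ‖x‖) ^ (1 + β) ≤ dist x a := fun a ha => by
      refine ⟨?_, by nlinarith [hcon a ha]⟩
      by_contra! hlt
      have h3 : ‖a‖ ≤ ‖x‖ + dist x a := by
        rw [dist_comm, dist_eq_norm]
        simpa using norm_add_le x (a - x)
      have h4 := hS.1 a ha
      have h5 : 1 + ‖a‖ ≤ 2 * (1 + ‖x‖) := by linarith
      have h6 : (1 + ‖a‖) ^ (1 + β) ≤ 2 ^ (1 + β) * (1 + ‖x‖) ^ (1 + β) := by
        rw [← Real.mul_rpow (by norm_num) (by positivity)]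
        exact Real.rpow_le_rpow (by positivity) h5 (by linarith)
      have := hcon a ha
      nlinarith
    have := hmax (insert x S) ⟨?_, ?_⟩
    · rw [Finset.card_insert_of_notMem hxS] at this
      omega
    · intro a ha
      rcases Finset.mem_insert.1 ha with rfl | ha
      · exact hx
      · exact hS.1 a ha
    · intro a ha a' ha' hne
      rcases Finset.mem_insert.1 ha with hax | haS <;>
        rcases Finset.mem_insert.1 ha' with hax' | haS'
      · exact absurd (hax.trans hax'.symm) hne
      · rw [hax]
        exact (hfar a' haS').symm
      · rw [hax', dist_comm]
        exact hfar a haS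
      · exact hS.2 a haS a' haS' hne
  · push Not at hx
    have h1 := hle 0 (by simp)
    rw [dist_zero_right] at h1
    nlinarith [norm_nonneg x]

end Geometry

section Pierce

variable {d : ℕ}

lemma ennreal_add_rpow_le (a b : ℝ≥0∞) {p : ℝ} (hp : 0 ≤ p) :
    (a + b) ^ p ≤ 2 ^ p * (a ^ p + b ^ p) := by
  wlog hab : a ≤ b generalizing a b
  · rw [add_comm a, add_comm (a ^ p)]
    exact this b a (le_of_not_ge hab)
  calc (a + b) ^ p ≤ (2 * b) ^ p := by
        apply ENNReal.rpow_le_rpow _ hp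
        rw [two_mul]
        gcongr
    _ = 2 ^ p * b ^ p := ENNReal.mul_rpow_of_nonneg _ _ hp
    _ ≤ _ := by gcongr; exact le_add_self

lemma qdist_nonneg (x : EuclideanSpace ℝ (Fin d)) (α : Finset (EuclideanSpace ℝ (Fin d))) :
    0 ≤ qdist x α := infDist_nonneg

lemma measurable_qdist (α : Finset (EuclideanSpace ℝ (Fin d))) :
    Measurable fun x => qdist x α :=
  (continuous_infDist_pt _).measurable

lemma exists_quantizer_qerr_le (hd : 1 ≤ d) {r η : ℝ} (hr : 0 < r) (hη : 0 < η)
    (P : Measure (EuclideanSpace ℝ (Fin d))) [IsProbabilityMeasure P]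
    (hmom : (∫⁻ x, ENNReal.ofReal ‖x‖ ^ (r + η) ∂P) ≠ ⊤) :
    ∃ C : ℝ, 0 < C ∧ ∀ n : ℕ, 2 ≤ n → ∀ h : ℝ, 0 < h → n * h ^ d = 1 →
      ∃ S : Finset (EuclideanSpace ℝ (Fin d)), S.Nonempty ∧ S.card ≤ n ∧
        qerr P r S ≤ ENNReal.ofReal (C * h ^ r) := by
  have hβ : 0 < η / r := by positivity
  obtain ⟨A, hA, hnet⟩ := exists_weighted_net (d := d) hd hβ
  set β := η / r with hβdef
  set M := ∫⁻ x, ENNReal.ofReal ((1 + ‖x‖) ^ (r + η)) ∂P with hM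
  have hMtop : M ≠ ⊤ := by
    have : M ≤ ∫⁻ x, 2 ^ (r + η) * (1 + ENNReal.ofReal ‖x‖ ^ (r + η)) ∂P := by
      refine lintegral_mono fun x => ?_
      rw [← ENNReal.ofReal_rpow_of_nonneg (by positivity) (by positivity),
        ENNReal.ofReal_add zero_le_one (norm_nonneg _)]
      simpa using ennreal_add_rpow_le 1 (ENNReal.ofReal ‖x‖) (p := r + η) (by positivity)
    refine ne_top_of_le_ne_top ?_ this
    have h2 : (2 : ℝ≥0∞) ^ (r + η) ≠ ⊤ := ENNReal.rpow_ne_top_of_nonneg (by positivity) (by simp)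
    rw [lintegral_const_mul' _ _ h2, lintegral_add_left measurable_const]
    refine ENNReal.mul_ne_top h2 (ENNReal.add_ne_top.2 ⟨by simp, hmom⟩)
  set k : ℝ := (2 * A) ^ (1 / (d : ℝ)) with hk
  have hkpos : 0 < k := by positivity
  have hkd : k ^ d = 2 * A := by
    rw [hk, one_div, Real.rpow_inv_natCast_pow (by positivity) (by omega)]
  refine ⟨(2 ^ (1 + β) * k) ^ r * (M.toReal + 1), by positivity, fun n hn h hh hnh => ?_⟩
  obtain ⟨S, hSne, hScard, hS⟩ := hnet (k * h) (by positivity)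
  refine ⟨S, hSne, ?_, ?_⟩
  · rw [mul_pow, hkd] at hScard
    have h1 : (S.card : ℝ) * (2 * A) ≤ A * n + 2 * A := by
      have hn0 : (0 : ℝ) ≤ n := by positivity
      have := mul_le_mul_of_nonneg_left hScard hn0
      have e1 : (n : ℝ) * (S.card * (2 * A * h ^ d)) = S.card * (2 * A) := by
        linear_combination (S.card * (2 * A)) * hnh
      have e2 : (n : ℝ) * (A + 2 * A * h ^ d) = A * n + 2 * A := by
        linear_combination (2 * A) * hnh
      linarith
    have hn' : (2 : ℝ) ≤ n := by exact_mod_cast hn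
    have : (S.card : ℝ) ≤ n := by
      by_contra! hlt
      nlinarith
    exact_mod_cast this
  · calc qerr P r S
        ≤ ∫⁻ x, ENNReal.ofReal ((2 ^ (1 + β) * k) ^ r * h ^ r) *
            ENNReal.ofReal ((1 + ‖x‖) ^ (r + η)) ∂P := by
          refine lintegral_mono fun x => ?_
          dsimp only
          rw [ENNReal.ofReal_rpow_of_nonneg (qdist_nonneg _ _) hr.le,
            ← ENNReal.ofReal_mul (by positivity)]
          apply ENNReal.ofReal_le_ofReal
          have e1 : (1 + ‖x‖) ^ (r + η) = ((1 + ‖x‖) ^ (1 + β)) ^ r := by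
            rw [← Real.rpow_mul (by positivity)]
            congr 1
            rw [hβdef]
            field_simp
          rw [e1, ← Real.mul_rpow (by positivity) hh.le,
            ← Real.mul_rpow (by positivity) (by positivity)]
          refine Real.rpow_le_rpow (qdist_nonneg _ _) ((hS x).trans_eq (by ring)) hr.le
      _ = ENNReal.ofReal ((2 ^ (1 + β) * k) ^ r * h ^ r) * M := by
          rw [lintegral_const_mul' _ _ ENNReal.ofReal_ne_top]
      _ ≤ ENNReal.ofReal ((2 ^ (1 + β) * k) ^ r * h ^ r) * ENNReal.ofReal (M.toReal + 1) := by
          gcongr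
          rw [← ENNReal.ofReal_toReal hMtop, ENNReal.toReal_ofReal ENNReal.toReal_nonneg]
          exact ENNReal.ofReal_le_ofReal (by linarith)
      _ = _ := by
          rw [← ENNReal.ofReal_mul (by positivity)]
          congr 1
          ring

lemma OptimalSeq.qerr_le {r : ℝ} (hr : 0 < r) {P : Measure (EuclideanSpace ℝ (Fin d))}
    {α : ℕ → Finset (EuclideanSpace ℝ (Fin d))} (hα : OptimalSeq P r α) {n : ℕ} (hn : 1 ≤ n)
    {S : Finset (EuclideanSpace ℝ (Fin d))} (hS : S.Nonempty) (hcard : S.card ≤ n) :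
    qerr P r (α n) ≤ qerr P r S := by
  rw [(hα n hn).2.2]
  calc enr P r n ^ r ≤ (qerr P r S ^ (1 / r)) ^ r := by
        apply ENNReal.rpow_le_rpow _ hr.le
        exact iInf_le_of_le S (iInf_le_of_le hS (iInf_le_of_le hcard le_rfl))
    _ = qerr P r S := by
        rw [← ENNReal.rpow_mul, one_div_mul_cancel hr.ne', ENNReal.rpow_one]

end Pierce

section Removal

variable {d : ℕ}

/-- The open Voronoi cell of `a` in the codebook `α`. -/
def voronoi (α : Finset (EuclideanSpace ℝ (Fin d))) (a : EuclideanSpace ℝ (Fin d)) :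
    Set (EuclideanSpace ℝ (Fin d)) :=
  {y | qdist y α < qdist y (α.erase a)}

lemma measurableSet_voronoi (α : Finset (EuclideanSpace ℝ (Fin d)))
    (a : EuclideanSpace ℝ (Fin d)) : MeasurableSet (voronoi α a) :=
  measurableSet_lt (measurable_qdist α) (measurable_qdist _)

lemma qdist_le_dist (x : EuclideanSpace ℝ (Fin d)) {α : Finset (EuclideanSpace ℝ (Fin d))}
    {a : EuclideanSpace ℝ (Fin d)} (ha : a ∈ α) : qdist x α ≤ dist x a :=
  infDist_le_dist_of_mem (Finset.mem_coe.2 ha)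

lemma exists_qdist_eq_dist (x : EuclideanSpace ℝ (Fin d))
    {α : Finset (EuclideanSpace ℝ (Fin d))} (hα : α.Nonempty) :
    ∃ a ∈ α, qdist x α = dist x a :=
  α.finite_toSet.isCompact.exists_infDist_eq_dist (Finset.coe_nonempty.2 hα) x

lemma eq_of_mem_voronoi {α : Finset (EuclideanSpace ℝ (Fin d))}
    {a a' y : EuclideanSpace ℝ (Fin d)} (hy : y ∈ voronoi α a) (ha' : a' ∈ α)
    (h : qdist y α = dist y a') : a' = a := by
  by_contra hne
  have h1 := qdist_le_dist y (Finset.mem_erase.2 ⟨hne, ha'⟩)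
  have h2 : qdist y α < qdist y (α.erase a) := hy
  linarith

lemma pairwiseDisjoint_voronoi {α : Finset (EuclideanSpace ℝ (Fin d))} (hα : α.Nonempty)
    (s : Set (EuclideanSpace ℝ (Fin d))) : s.PairwiseDisjoint (voronoi α) := by
  intro a _ a' _ hne
  refine Set.disjoint_left.2 fun y hy hy' => hne ?_
  obtain ⟨a₀, h₀, he⟩ := exists_qdist_eq_dist y hα
  exact (eq_of_mem_voronoi hy h₀ he).symm.trans (eq_of_mem_voronoi hy' h₀ he)

lemma exists_card_near_mul_pow_ge {r : ℝ} (hr : 0 < r)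
    {f : EuclideanSpace ℝ (Fin d) → ℝ}
    {P : Measure (EuclideanSpace ℝ (Fin d))} [IsProbabilityMeasure P]
    (hP : P = volume.withDensity fun x => ENNReal.ofReal (f x)) {C₀ : ℝ} (hC₀ : 0 < C₀) :
    ∃ R > 0, ∃ c > 0, ∃ h₀ > 0, ∀ h : ℝ, 0 < h → h ≤ h₀ →
      ∀ α : Finset (EuclideanSpace ℝ (Fin d)), α.Nonempty →
      qerr P r α ≤ ENNReal.ofReal (C₀ * h ^ r) →
      c ≤ (α.filter fun a => ‖a‖ ≤ R).card * h ^ d := by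
  have hPs : ∀ s, P s = ∫⁻ x in s, ENNReal.ofReal (f x) := fun s => by
    rw [hP, withDensity_apply' _ s]
  have hfin : ∫⁻ x, ENNReal.ofReal (f x) ≠ ⊤ := by
    rw [← setLIntegral_univ, ← hPs]
    exact measure_ne_top _ _
  obtain ⟨δ₀, hδ₀, hac⟩ := exists_pos_setLIntegral_lt_of_measure_lt hfin
    (ε := 1 / 4) (by simp)
  obtain ⟨δ, hδ, hδ'⟩ : ∃ δ : ℝ, 0 < δ ∧ ENNReal.ofReal δ ≤ δ₀ := by
    refine ⟨(min δ₀ 1).toReal, ENNReal.toReal_pos (by simp [hδ₀.ne']) (by simp), ?_⟩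
    rw [ENNReal.ofReal_toReal (by simp)]
    exact min_le_left _ _
  obtain ⟨R, hR, hPR⟩ : ∃ R : ℝ, 0 < R ∧ 3 / 4 < P (ball 0 R) := by
    have hmono : Monotone fun n : ℕ => ball (0 : EuclideanSpace ℝ (Fin d)) n :=
      fun m n hmn => ball_subset_ball (by exact_mod_cast hmn)
    have hlim := tendsto_measure_iUnion_atTop (μ := P) hmono
    rw [iUnion_ball_nat, measure_univ] at hlim
    have h34 : (3 / 4 : ℝ≥0∞) < 1 := by
      rw [ENNReal.div_lt_iff (by simp) (by simp)]
      norm_num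
    obtain ⟨n, hn, hn'⟩ := ((hlim.eventually (lt_mem_nhds h34)).and
      (eventually_ge_atTop 1)).exists
    exact ⟨n, by exact_mod_cast hn', hn⟩
  set K : ℝ := (4 * C₀) ^ (1 / r) with hK
  have hKpos : 0 < K := by positivity
  have hKr : K ^ r = 4 * C₀ := by
    rw [hK, ← Real.rpow_mul (by positivity), one_div_mul_cancel hr.ne', Real.rpow_one]
  have hV := ballVol_pos d
  refine ⟨R + 1, by positivity, δ / (K ^ d * ballVol d), by positivity, 1 / K, by positivity,
    fun h hh hh₀ α hα hq => ?_⟩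
  by_contra! hlt
  set S := α.filter fun a => ‖a‖ ≤ R + 1 with hS
  set t := K * h with ht
  have htpos : 0 < t := by positivity
  have ht1 : t ≤ 1 := by
    rw [le_div_iff₀ hKpos] at hh₀
    linarith
  set N : Set (EuclideanSpace ℝ (Fin d)) := ⋃ a ∈ S, ball a t with hN
  have hNvol : volume N < δ₀ := by
    refine lt_of_lt_of_le ?_ hδ'
    calc volume N ≤ ∑ a ∈ S, volume (ball a t) := measure_biUnion_finset_le _ _
      _ = S.card * ENNReal.ofReal (t ^ d * ballVol d) := by
          rw [Finset.sum_congr rfl fun a _ => volume_ball_eq a htpos, Finset.sum_const,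
            nsmul_eq_mul]
      _ = ENNReal.ofReal (S.card * (t ^ d * ballVol d)) := by
          rw [ENNReal.ofReal_mul (p := (S.card : ℝ)) (by positivity), ENNReal.ofReal_natCast]
      _ < ENNReal.ofReal δ := by
          rw [ENNReal.ofReal_lt_ofReal_iff hδ]
          rw [lt_div_iff₀ (by positivity)] at hlt
          calc _ = _ := by rw [ht, mul_pow]; ring
            _ < δ := hlt
  have hPN : P N < 1 / 4 := by
    rw [hPs]
    exact hac N hNvol
  have hNm : MeasurableSet N := S.measurableSet_biUnion fun a _ => measurableSet_ball
  have hhalf : ENNReal.ofReal (1 / 2) ≤ P (ball 0 R \ N) := by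
    have h1 : P (ball 0 R) ≤ P (ball 0 R \ N) + P N := by
      calc P (ball 0 R) ≤ P ((ball 0 R \ N) ∪ N) := measure_mono (by simp)
        _ ≤ _ := measure_union_le _ _
    by_contra! hcon
    have h2 : P (ball 0 R \ N) + P N < ENNReal.ofReal (1 / 2) + 1 / 4 := ENNReal.add_lt_add hcon hPN
    have h3 : ENNReal.ofReal (1 / 2) + 1 / 4 = 3 / 4 := by
      rw [show (1 / 4 : ℝ≥0∞) = ENNReal.ofReal (1 / 4) by
          rw [ENNReal.ofReal_div_of_pos (by norm_num)]; simp,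
        show (3 / 4 : ℝ≥0∞) = ENNReal.ofReal (3 / 4) by
          rw [ENNReal.ofReal_div_of_pos (by norm_num)]; simp,
        ← ENNReal.ofReal_add (by norm_num) (by norm_num)]
      norm_num
    rw [h3] at h2
    exact absurd (hPR.trans_le (h1.trans h2.le)) (lt_irrefl _)
  have hfar : ∀ y ∈ ball (0 : EuclideanSpace ℝ (Fin d)) R \ N, t ≤ qdist y α := by
    rintro y ⟨hyR, hyN⟩
    refine (le_infDist (Finset.coe_nonempty.2 hα)).2 fun a ha => ?_
    by_cases haR : ‖a‖ ≤ R + 1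
    · by_contra! hcon
      exact hyN (mem_biUnion (Finset.mem_coe.2 (Finset.mem_filter.2 ⟨Finset.mem_coe.1 ha, haR⟩))
        hcon)
    · have h1 : ‖a‖ ≤ ‖y‖ + dist y a := by
        rw [dist_comm, dist_eq_norm]
        simpa using norm_add_le y (a - y)
      have h2 : ‖y‖ < R := by simpa using hyR
      linarith
  have hbig : ENNReal.ofReal (t ^ r * (1 / 2)) ≤ qerr P r α := by
    calc ENNReal.ofReal (t ^ r * (1 / 2))
        = ENNReal.ofReal (t ^ r) * ENNReal.ofReal (1 / 2) :=
          ENNReal.ofReal_mul (by positivity)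
      _ ≤ ENNReal.ofReal (t ^ r) * P (ball 0 R \ N) := by gcongr
      _ = ∫⁻ y in ball 0 R \ N, ENNReal.ofReal (t ^ r) ∂P := (setLIntegral_const _ _).symm
      _ ≤ ∫⁻ y in ball 0 R \ N, ENNReal.ofReal (qdist y α) ^ r ∂P := by
          refine setLIntegral_mono' (measurableSet_ball.diff hNm) fun y hy => ?_
          rw [ENNReal.ofReal_rpow_of_nonneg (qdist_nonneg _ _) hr.le]
          exact ENNReal.ofReal_le_ofReal (Real.rpow_le_rpow htpos.le (hfar y hy) hr.le)
      _ ≤ _ := setLIntegral_le_lintegral _ _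
  have hfinal := hbig.trans hq
  rw [ENNReal.ofReal_le_ofReal_iff (by positivity), ht, Real.mul_rpow hKpos.le hh.le, hKr] at hfinal
  have : 0 < C₀ * h ^ r := by positivity
  linarith

lemma exists_sum_separation_pow_le (hd : 1 ≤ d) {R : ℝ} (hR : 0 < R) :
    ∃ A : ℝ, 0 < A ∧ ∀ α : Finset (EuclideanSpace ℝ (Fin d)),
      2 ≤ (α.filter fun a => ‖a‖ ≤ R).card →
      ∑ a ∈ α.filter (fun a => ‖a‖ ≤ R), ENNReal.ofReal (qdist a (α.erase a) ^ d) ≤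
        ENNReal.ofReal A := by
  have hV := ballVol_pos d
  refine ⟨(2 * (2 * R)) ^ d, by positivity, fun α h2 => ?_⟩
  set S := α.filter fun a => ‖a‖ ≤ R with hS
  have hsep : ∀ a ∈ S, ∀ a' ∈ S, a ≠ a' → qdist a (α.erase a) ≤ dist a a' := by
    intro a _ a' ha' hne
    exact qdist_le_dist a (Finset.mem_erase.2 ⟨hne.symm, (Finset.mem_filter.1 ha').1⟩)
  have hsum := sum_volume_ball_le (μ := volume.restrict (ball 0 (2 * R))) S
    (fun a => qdist a (α.erase a) / 2) (fun a ha a' ha' hne => by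
      have h1 := hsep a ha a' ha' hne
      have h3 := hsep a' ha' a ha hne.symm
      rw [dist_comm a' a] at h3
      linarith) (fun _ => 1)
  have hterm : ∀ a ∈ S, ENNReal.ofReal (qdist a (α.erase a) ^ d * ((2⁻¹) ^ d * ballVol d)) ≤
      ∫⁻ _ in ball a (qdist a (α.erase a) / 2), 1 ∂(volume.restrict (ball 0 (2 * R))) := by
    intro a ha
    rcases (qdist_nonneg a (α.erase a)).eq_or_lt with h0 | hpos
    · rw [← h0, zero_pow (by omega)]
      simp
    · obtain ⟨a', ha', hne⟩ := Finset.exists_mem_ne (s := S) (by omega) a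
      have haR := (Finset.mem_filter.1 ha).2
      have haR' := (Finset.mem_filter.1 ha').2
      have hle : qdist a (α.erase a) ≤ 2 * R := by
        refine (hsep a ha a' ha' hne.symm).trans ?_
        rw [dist_eq_norm]
        linarith [norm_sub_le a a']
      have hsub : ball a (qdist a (α.erase a) / 2) ⊆ ball 0 (2 * R) := by
        apply ball_subset_ball'
        rw [dist_zero_right]
        linarith
      rw [setLIntegral_one, Measure.restrict_apply measurableSet_ball,
        inter_eq_left.2 hsub, volume_ball_eq _ (by positivity), div_eq_mul_inv, mul_pow, mul_assoc]
  have htot := (Finset.sum_le_sum hterm).trans hsum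
  rw [lintegral_one, Measure.restrict_apply_univ, volume_ball_eq _ (by positivity)] at htot
  have hc : 0 < (2⁻¹ : ℝ) ^ d * ballVol d := by positivity
  rw [← ENNReal.ofReal_sum_of_nonneg (fun a _ => by have := qdist_nonneg a (α.erase a); positivity),
    ENNReal.ofReal_le_ofReal_iff (by positivity), ← Finset.sum_mul] at htot
  rw [← ENNReal.ofReal_sum_of_nonneg (fun a _ => by have := qdist_nonneg a (α.erase a); positivity)]
  apply ENNReal.ofReal_le_ofReal
  refine le_of_mul_le_mul_right (htot.trans_eq ?_) hc
  have e : (2 : ℝ) ^ d * (2⁻¹) ^ d = 1 := by rw [← mul_pow]; norm_num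
  rw [mul_pow 2 (2 * R)]
  linear_combination (-((2 * R) ^ d * ballVol d)) * e

lemma exists_removal_le (hd : 1 ≤ d) {r : ℝ} (hr : 0 < r)
    (P : Measure (EuclideanSpace ℝ (Fin d))) [IsProbabilityMeasure P]
    {R c C₀ : ℝ} (hR : 0 < R) (hc : 0 < c) (hC₀ : 0 < C₀) :
    ∃ C : ℝ, 0 < C ∧ ∀ h : ℝ, 0 < h → ∀ α : Finset (EuclideanSpace ℝ (Fin d)),
      2 ≤ (α.filter fun a => ‖a‖ ≤ R).card →
      c ≤ (α.filter fun a => ‖a‖ ≤ R).card * h ^ d →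
      qerr P r α ≤ ENNReal.ofReal (C₀ * h ^ r) →
      ∃ a ∈ α, (α.erase a).Nonempty ∧
        ∫⁻ y in voronoi α a, ENNReal.ofReal (qdist y (α.erase a)) ^ r ∂P ≤
          ENNReal.ofReal (C * (h ^ d * h ^ r)) := by
  obtain ⟨A, hA, hsep⟩ := exists_sum_separation_pow_le (d := d) hd hR
  set B : ℝ := (1 + C₀ + A) / c with hB
  have hBpos : 0 < B := by positivity
  set B' : ℝ := B ^ (1 / (d : ℝ)) with hB'
  have hB'pos : 0 < B' := by positivity
  have hB'd : B' ^ d = B := by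
    rw [hB', one_div, Real.rpow_inv_natCast_pow (by positivity) (by omega)]
  refine ⟨2 ^ r * (B + B' ^ r * B), by positivity, fun h hh α h2 hcard hq => ?_⟩
  set S := α.filter fun a => ‖a‖ ≤ R with hS
  have hSne : S.Nonempty := Finset.card_pos.1 (by omega)
  have hα : α.Nonempty := hSne.mono (Finset.filter_subset _ _)
  set D : EuclideanSpace ℝ (Fin d) → ℝ≥0∞ := fun a =>
    ∫⁻ y in voronoi α a, ENNReal.ofReal (qdist y α) ^ r ∂P with hD
  set F : EuclideanSpace ℝ (Fin d) → ℝ≥0∞ := fun a =>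
    P (voronoi α a) + ENNReal.ofReal ((h ^ r)⁻¹) * D a +
      ENNReal.ofReal (qdist a (α.erase a) ^ d) with hF
  have hdisj := pairwiseDisjoint_voronoi hα (S : Set (EuclideanSpace ℝ (Fin d)))
  have hsumF : ∑ a ∈ S, F a ≤ ENNReal.ofReal (1 + C₀ + A) := by
    rw [ENNReal.ofReal_add (by positivity) hA.le, ENNReal.ofReal_add zero_le_one hC₀.le]
    simp only [hF, Finset.sum_add_distrib]
    gcongr
    · rw [← measure_biUnion_finset hdisj fun a _ => measurableSet_voronoi α a]
      simpa using prob_le_one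
    · rw [← Finset.mul_sum]
      calc ENNReal.ofReal ((h ^ r)⁻¹) * ∑ a ∈ S, D a
          ≤ ENNReal.ofReal ((h ^ r)⁻¹) * ENNReal.ofReal (C₀ * h ^ r) := by
            gcongr
            rw [hD, ← lintegral_biUnion_finset hdisj fun a _ => measurableSet_voronoi α a]
            exact (setLIntegral_le_lintegral _ _).trans hq
        _ = ENNReal.ofReal C₀ := by
            rw [← ENNReal.ofReal_mul (by positivity)]
            congr 1
            have : h ^ r ≠ 0 := by positivity
            field_simp
    · exact hsep α h2
  obtain ⟨a, haS, hmin⟩ := S.exists_min_image F hSne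
  have haα : a ∈ α := (Finset.mem_filter.1 haS).1
  have hFa : F a ≤ ENNReal.ofReal (B * h ^ d) := by
    have h1 : (S.card : ℝ≥0∞) * F a ≤ ENNReal.ofReal (1 + C₀ + A) := by
      rw [← nsmul_eq_mul]
      exact (Finset.card_nsmul_le_sum _ _ _ hmin).trans hsumF
    have h3 : ENNReal.ofReal c * F a ≤ ENNReal.ofReal ((1 + C₀ + A) * h ^ d) := by
      calc ENNReal.ofReal c * F a ≤ ENNReal.ofReal (S.card * h ^ d) * F a := by gcongr
        _ = ENNReal.ofReal (h ^ d) * (S.card * F a) := by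
            rw [ENNReal.ofReal_mul (by positivity), ENNReal.ofReal_natCast]
            ring
        _ ≤ ENNReal.ofReal (h ^ d) * ENNReal.ofReal (1 + C₀ + A) := by gcongr
        _ = _ := by rw [← ENNReal.ofReal_mul (by positivity), mul_comm]
    have hc0 : ENNReal.ofReal c ≠ 0 := by simpa using hc
    rw [← ENNReal.mul_le_mul_iff_right hc0 ENNReal.ofReal_ne_top]
    refine h3.trans_eq ?_
    rw [← ENNReal.ofReal_mul hc.le, hB]
    congr 1
    field_simp
  have hPa : P (voronoi α a) ≤ ENNReal.ofReal (B * h ^ d) :=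
    (le_self_add.trans le_self_add).trans hFa
  have hDa : D a ≤ ENNReal.ofReal (h ^ r * (B * h ^ d)) := by
    have h1 : ENNReal.ofReal ((h ^ r)⁻¹) * D a ≤ ENNReal.ofReal (B * h ^ d) :=
      (le_add_self.trans le_self_add).trans hFa
    calc D a = ENNReal.ofReal (h ^ r) * (ENNReal.ofReal ((h ^ r)⁻¹) * D a) := by
          rw [← mul_assoc, ← ENNReal.ofReal_mul (by positivity), mul_inv_cancel₀ (by positivity)]
          simp
      _ ≤ ENNReal.ofReal (h ^ r) * ENNReal.ofReal (B * h ^ d) := by gcongr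
      _ = _ := by rw [← ENNReal.ofReal_mul (by positivity)]
  have hρ : qdist a (α.erase a) ≤ B' * h := by
    have h1 : ENNReal.ofReal (qdist a (α.erase a) ^ d) ≤ ENNReal.ofReal (B * h ^ d) :=
      le_add_self.trans hFa
    rw [ENNReal.ofReal_le_ofReal_iff (by positivity), ← hB'd, ← mul_pow] at h1
    exact le_of_pow_le_pow_left₀ (by omega) (by positivity) h1
  refine ⟨a, haα, ?_, ?_⟩
  · obtain ⟨a', ha', hne⟩ := Finset.exists_mem_ne (s := S) (by omega) a
    exact ⟨a', Finset.mem_erase.2 ⟨hne, (Finset.mem_filter.1 ha').1⟩⟩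
  have h2r : (2 : ℝ≥0∞) ^ r = ENNReal.ofReal (2 ^ r) := by
    rw [← ENNReal.ofReal_rpow_of_nonneg (by norm_num) hr.le]
    simp
  calc ∫⁻ y in voronoi α a, ENNReal.ofReal (qdist y (α.erase a)) ^ r ∂P
      ≤ ∫⁻ y in voronoi α a, ENNReal.ofReal (2 ^ r) *
          (ENNReal.ofReal ((B' * h) ^ r) + ENNReal.ofReal (qdist y α) ^ r) ∂P := by
        refine setLIntegral_mono' (measurableSet_voronoi α a) fun y hy => ?_
        obtain ⟨a₀, h₀, he⟩ := exists_qdist_eq_dist y hα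
        obtain rfl := eq_of_mem_voronoi hy h₀ he
        rw [← h2r, ← ENNReal.ofReal_rpow_of_nonneg (by positivity) hr.le]
        refine (ENNReal.rpow_le_rpow ?_ hr.le).trans (ennreal_add_rpow_le _ _ hr.le)
        rw [← ENNReal.ofReal_add (by positivity) (qdist_nonneg _ _)]
        apply ENNReal.ofReal_le_ofReal
        have h1 : qdist y (α.erase a₀) ≤ qdist a₀ (α.erase a₀) + dist y a₀ :=
          infDist_le_infDist_add_dist
        linarith
    _ = ENNReal.ofReal (2 ^ r) *
          (ENNReal.ofReal ((B' * h) ^ r) * P (voronoi α a) + D a) := by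
        rw [lintegral_const_mul' _ _ ENNReal.ofReal_ne_top, lintegral_add_left measurable_const,
          setLIntegral_const]
    _ ≤ ENNReal.ofReal (2 ^ r) * (ENNReal.ofReal ((B' * h) ^ r) * ENNReal.ofReal (B * h ^ d) +
          ENNReal.ofReal (h ^ r * (B * h ^ d))) := by gcongr
    _ = _ := by
        rw [← ENNReal.ofReal_mul (by positivity), ← ENNReal.ofReal_add (by positivity)
          (by positivity), ← ENNReal.ofReal_mul (by positivity), Real.mul_rpow hB'pos.le hh.le]
        congr 1
        ring

end Removal

section MaximalFunction

variable {d : ℕ}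

lemma mul_measure_ball_le_of_optimal {r b : ℝ} (hr : 0 < r) (hb : b ∈ Ioo (0 : ℝ) (1 / 2))
    {P : Measure (EuclideanSpace ℝ (Fin d))} {α : Finset (EuclideanSpace ℝ (Fin d))}
    (hopt : ∀ S : Finset (EuclideanSpace ℝ (Fin d)), S.Nonempty → S.card ≤ α.card →
      qerr P r α ≤ qerr P r S)
    (hfin : qerr P r α ≠ ⊤) {a : EuclideanSpace ℝ (Fin d)} (ha : a ∈ α)
    (hne : (α.erase a).Nonempty) (x : EuclideanSpace ℝ (Fin d)) :
    ENNReal.ofReal (((1 - b) ^ r - b ^ r) * qdist x α ^ r) * P (ball x (b * qdist x α)) ≤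
      ∫⁻ y in voronoi α a, ENNReal.ofReal (qdist y (α.erase a)) ^ r ∂P := by
  set D := qdist x α with hD
  have hD0 : 0 ≤ D := qdist_nonneg _ _
  set k : ℝ := ((1 - b) ^ r - b ^ r) * D ^ r with hk
  have hk0 : 0 ≤ k := by
    have : b ^ r ≤ (1 - b) ^ r := Real.rpow_le_rpow hb.1.le (by linarith [hb.2]) hr.le
    exact mul_nonneg (by linarith) (Real.rpow_nonneg hD0 _)
  set S := insert x (α.erase a) with hS
  have hcard : S.card ≤ α.card := by
    have := Finset.card_insert_le x (α.erase a)
    rw [Finset.card_erase_of_mem ha] at this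
    have := Finset.card_pos.2 ⟨a, ha⟩
    rw [hS]
    omega
  have hpt : ∀ y, ENNReal.ofReal (qdist y S) ^ r +
      (ball x (b * D)).indicator (fun _ => ENNReal.ofReal k) y ≤
      ENNReal.ofReal (qdist y α) ^ r +
      (voronoi α a).indicator (fun y => ENNReal.ofReal (qdist y (α.erase a)) ^ r) y := by
    intro y
    by_cases hy : y ∈ ball x (b * D)
    · rw [indicator_of_mem hy]
      refine le_trans ?_ le_self_add
      have h1 : dist y x < b * D := hy
      have h2 : qdist y S ≤ b * D := (qdist_le_dist y (Finset.mem_insert_self _ _)).trans h1.le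
      have h3 : (1 - b) * D ≤ qdist y α := by
        have : D ≤ qdist y α + dist x y := infDist_le_infDist_add_dist
        rw [dist_comm] at this
        linarith
      rw [ENNReal.ofReal_rpow_of_nonneg (qdist_nonneg _ _) hr.le,
        ENNReal.ofReal_rpow_of_nonneg (qdist_nonneg _ _) hr.le,
        ← ENNReal.ofReal_add (Real.rpow_nonneg (qdist_nonneg _ _) _) hk0]
      apply ENNReal.ofReal_le_ofReal
      have hb1 : 0 ≤ 1 - b := by linarith [hb.2]
      have h4 := Real.rpow_le_rpow (qdist_nonneg _ _) h2 hr.le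
      have h5 := Real.rpow_le_rpow (mul_nonneg hb1 hD0) h3 hr.le
      rw [Real.mul_rpow hb.1.le hD0] at h4
      rw [Real.mul_rpow hb1 hD0] at h5
      rw [hk]
      linarith
    · rw [indicator_of_notMem hy, add_zero]
      have h1 : qdist y S ≤ qdist y (α.erase a) :=
        infDist_le_infDist_of_subset (by rw [hS]; simp) (Finset.coe_nonempty.2 hne)
      by_cases hv : y ∈ voronoi α a
      · rw [indicator_of_mem hv]
        refine le_trans ?_ le_add_self
        gcongr
      · have h2 : qdist y (α.erase a) ≤ qdist y α := not_lt.1 hv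
        refine le_trans ?_ le_self_add
        gcongr
        exact h1.trans h2
  have hint := lintegral_mono (μ := P) hpt
  have hm : ∀ γ : Finset (EuclideanSpace ℝ (Fin d)),
      Measurable fun y => ENNReal.ofReal (qdist y γ) ^ r := fun γ =>
    (measurable_qdist γ).ennreal_ofReal.pow_const r
  rw [lintegral_add_left (hm S), lintegral_add_left (hm α),
    lintegral_indicator measurableSet_ball, lintegral_indicator (measurableSet_voronoi α a),
    setLIntegral_const] at hint
  have hSopt := hopt S (Finset.insert_nonempty _ _) hcard
  have h6 : qerr P r α + ENNReal.ofReal k * P (ball x (b * D)) ≤ qerr P r α +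
      ∫⁻ y in voronoi α a, ENNReal.ofReal (qdist y (α.erase a)) ^ r ∂P :=
    le_trans (by gcongr; exact hSopt) hint
  exact (ENNReal.add_le_add_iff_left hfin).1 h6

lemma ofReal_mul_qdist_pow_le_maxFun {r b c L : ℝ} (hd : 1 ≤ d) (hb : 0 < b) (hc : 0 < c)
    (hL : 0 < L)
    {P : Measure (EuclideanSpace ℝ (Fin d))} [IsFiniteMeasure P]
    {α : ℕ → Finset (EuclideanSpace ℝ (Fin d))} {n : ℕ} (hn : 1 ≤ n)
    (x : EuclideanSpace ℝ (Fin d))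
    (h : ENNReal.ofReal (c * qdist x (α n) ^ r) * P (ball x (b * qdist x (α n))) ≤
      ENNReal.ofReal L) :
    ENNReal.ofReal (c * ballVol d * b ^ d * (qdist x (α n) ^ d * qdist x (α n) ^ r)) ≤
      ENNReal.ofReal L * maxFun P α b x := by
  have hV := ballVol_pos d
  rcases (qdist_nonneg x (α n)).eq_or_lt with h0 | hpos
  · rw [← h0, zero_pow (by omega)]
    simp
  set D := qdist x (α n) with hD
  have hvol := volume_ball_eq x (mul_pos hb hpos)
  have hψ : volume (ball x (b * D)) / P (ball x (b * D)) ≤ maxFun P α b x :=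
    le_iSup₂_of_le n hn le_rfl
  by_cases hP0 : P (ball x (b * D)) = 0
  · rw [hP0, ENNReal.div_zero (measure_ball_pos _ _ (mul_pos hb hpos)).ne', top_le_iff] at hψ
    rw [hψ, ENNReal.mul_top (by simpa using hL)]
    exact le_top
  · calc ENNReal.ofReal (c * ballVol d * b ^ d * (D ^ d * D ^ r))
        = ENNReal.ofReal (c * D ^ r) * volume (ball x (b * D)) := by
          rw [hvol, ← ENNReal.ofReal_mul (by positivity)]
          congr 1
          ring
      _ = ENNReal.ofReal (c * D ^ r) * P (ball x (b * D)) *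
            (volume (ball x (b * D)) / P (ball x (b * D))) := by
          rw [mul_assoc, ENNReal.mul_div_cancel hP0 (measure_ne_top _ _)]
      _ ≤ _ := by gcongr

lemma ofReal_qdist_rpow_le_maxFun {r s b c C h : ℝ} (hd : 1 ≤ d) (hr : 0 < r) (hs : 0 < s)
    (hb : 0 < b) (hc : 0 < c) (hC : 0 < C) (hh : 0 < h)
    {P : Measure (EuclideanSpace ℝ (Fin d))} [IsFiniteMeasure P]
    {α : ℕ → Finset (EuclideanSpace ℝ (Fin d))} {n : ℕ} (hn : 1 ≤ n)
    (x : EuclideanSpace ℝ (Fin d))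
    (hle : ENNReal.ofReal (c * qdist x (α n) ^ r) * P (ball x (b * qdist x (α n))) ≤
      ENNReal.ofReal (C * (h ^ d * h ^ r))) :
    ENNReal.ofReal (qdist x (α n)) ^ s ≤
      ENNReal.ofReal ((C / (c * ballVol d * b ^ d)) ^ (s / ((d : ℝ) + r)) * h ^ s) *
        maxFun P α b x ^ (s / ((d : ℝ) + r)) := by
  have hV := ballVol_pos d
  have key := ofReal_mul_qdist_pow_le_maxFun hd hb hc (by positivity) hn x hle
  set D := qdist x (α n) with hD
  have hD0 : 0 ≤ D := qdist_nonneg _ _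
  set p := s / ((d : ℝ) + r) with hp
  have hdr : 0 < (d : ℝ) + r := by positivity
  have hp0 : 0 < p := by positivity
  set κ := c * ballVol d * b ^ d with hκ
  have hκ0 : 0 < κ := by positivity
  have hpow : ∀ t : ℝ, 0 ≤ t → (t ^ d * t ^ r) ^ p = t ^ s := fun t ht => by
    rw [← Real.rpow_natCast, ← Real.rpow_add_of_nonneg ht (by positivity) hr.le,
      ← Real.rpow_mul ht, hp, mul_div_cancel₀ _ hdr.ne']
  have h1 : ENNReal.ofReal (D ^ d * D ^ r) ≤
      ENNReal.ofReal (C / κ * (h ^ d * h ^ r)) * maxFun P α b x := by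
    calc ENNReal.ofReal (D ^ d * D ^ r)
        = ENNReal.ofReal κ⁻¹ * ENNReal.ofReal (κ * (D ^ d * D ^ r)) := by
          rw [← ENNReal.ofReal_mul (by positivity), inv_mul_cancel_left₀ hκ0.ne']
      _ ≤ ENNReal.ofReal κ⁻¹ * (ENNReal.ofReal (C * (h ^ d * h ^ r)) * maxFun P α b x) := by
          gcongr
      _ = _ := by
          rw [← mul_assoc, ← ENNReal.ofReal_mul (by positivity)]
          congr 2
          ring
  have h2 := ENNReal.rpow_le_rpow h1 hp0.le
  rw [ENNReal.mul_rpow_of_nonneg _ _ hp0.le, ENNReal.ofReal_rpow_of_nonneg (by positivity) hp0.le,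
    ENNReal.ofReal_rpow_of_nonneg (by positivity) hp0.le, hpow D hD0,
    Real.mul_rpow (by positivity) (by positivity), hpow h hh.le,
    ← ENNReal.ofReal_rpow_of_nonneg hD0 hs.le] at h2
  exact h2

lemma tendsto_qdist_zero {r : ℝ} (hr : 0 < r) {P : Measure (EuclideanSpace ℝ (Fin d))}
    {α : ℕ → Finset (EuclideanSpace ℝ (Fin d))}
    (hq : Tendsto (fun n => qerr P r (α n)) atTop (𝓝 0)) {x : EuclideanSpace ℝ (Fin d)}
    (hx : ∀ ε > 0, 0 < P (ball x ε)) : Tendsto (fun n => qdist x (α n)) atTop (𝓝 0) := by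
  rw [Metric.tendsto_nhds]
  intro ε hε
  have hε2 : 0 < ε / 2 := by positivity
  have hpos : 0 < ENNReal.ofReal (ε / 2) ^ r * P (ball x (ε / 2)) :=
    ENNReal.mul_pos (ENNReal.rpow_pos (by simpa using hε) ENNReal.ofReal_ne_top).ne' (hx _ hε2).ne'
  filter_upwards [hq.eventually (gt_mem_nhds hpos)] with n hn
  rw [Real.dist_0_eq_abs, abs_of_nonneg (qdist_nonneg _ _)]
  by_contra! hcon
  refine absurd hn (not_lt.2 ?_)
  calc ENNReal.ofReal (ε / 2) ^ r * P (ball x (ε / 2))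
      = ∫⁻ _ in ball x (ε / 2), ENNReal.ofReal (ε / 2) ^ r ∂P := (setLIntegral_const _ _).symm
    _ ≤ ∫⁻ y in ball x (ε / 2), ENNReal.ofReal (qdist y (α n)) ^ r ∂P := by
        refine setLIntegral_mono' measurableSet_ball fun y hy => ?_
        have h1 : qdist x (α n) ≤ qdist y (α n) + dist x y := infDist_le_infDist_add_dist
        have h2 : dist y x < ε / 2 := hy
        rw [dist_comm] at h2
        gcongr
        linarith
    _ ≤ _ := setLIntegral_le_lintegral _ _

lemma ae_inv_density_le_maxFun {r b : ℝ} (hd : 1 ≤ d) (hr : 0 < r) (hb : 0 < b)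
    {f : EuclideanSpace ℝ (Fin d) → ℝ} (hfm : Measurable f)
    {P : Measure (EuclideanSpace ℝ (Fin d))} [IsFiniteMeasure P]
    (hP : P = volume.withDensity fun x => ENNReal.ofReal (f x))
    {α : ℕ → Finset (EuclideanSpace ℝ (Fin d))} (hα : ∀ n, 1 ≤ n → (α n).Nonempty)
    (hq : Tendsto (fun n => qerr P r (α n)) atTop (𝓝 0)) :
    ∀ᵐ x ∂P, (ENNReal.ofReal (f x))⁻¹ ≤ maxFun P α b x := by
  have : Nontrivial (EuclideanSpace ℝ (Fin d)) :=
    Module.nontrivial_of_finrank_pos (R := ℝ) (by rw [finrank_euclideanSpace_fin]; omega)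
  have hac : P ≪ volume := hP ▸ withDensity_absolutelyContinuous _ _
  have hball : ∀ x t, P (closedBall x t) = P (ball x t) := fun x t => by
    refine measure_congr (hac.ae_eq ?_)
    exact (ae_eq_of_subset_of_measure_ge ball_subset_closedBall
      (Measure.addHaar_closedBall_eq_addHaar_ball _ _ _).le measurableSet_ball.nullMeasurableSet
      measure_closedBall_lt_top.ne).symm
  have hrn : P.rnDeriv volume =ᵐ[volume] fun x => ENNReal.ofReal (f x) := by
    conv_lhs => rw [hP]
    exact Measure.rnDeriv_withDensity _ hfm.ennreal_ofReal
  have hcount : ∀ᵐ x ∂(volume : Measure (EuclideanSpace ℝ (Fin d))),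
      x ∉ ⋃ n, (α n : Set (EuclideanSpace ℝ (Fin d))) :=
    measure_eq_zero_iff_ae_notMem.1
      ((countable_iUnion fun n => (α n).countable_toSet).measure_zero volume)
  have hpos : ∀ᵐ x ∂P, ENNReal.ofReal (f x) ≠ 0 := by
    conv => rw [hP]
    rw [ae_withDensity_iff hfm.ennreal_ofReal]
    exact ae_of_all _ fun x hx => hx
  filter_upwards [hac.ae_le hrn, hac.ae_le hcount, hpos,
    hac.ae_le (Besicovitch.ae_tendsto_rnDeriv P volume)] with x hxrn hxc hx0 hlim
  rw [hxrn] at hlim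
  simp only [hball, Measure.addHaar_closedBall_eq_addHaar_ball] at hlim
  have hsupp : ∀ ε > 0, 0 < P (ball x ε) := by
    intro ε hε
    obtain ⟨t, ht, htε⟩ := ((hlim.eventually (lt_mem_nhds (pos_iff_ne_zero.2 hx0))).and
      (Ioo_mem_nhdsGT hε)).exists
    have h1 : P (ball x t) ≠ 0 := fun h => by simp [h] at ht
    exact (pos_iff_ne_zero.2 h1).trans_le (measure_mono (ball_subset_ball htε.2.le))
  have hDpos : ∀ n, 1 ≤ n → 0 < qdist x (α n) := fun n hn => by
    obtain ⟨a, ha, he⟩ := exists_qdist_eq_dist x (hα n hn)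
    rw [he]
    refine dist_pos.2 ?_
    rintro rfl
    exact hxc (mem_iUnion.2 ⟨n, ha⟩)
  have hDlim : Tendsto (fun n => b * qdist x (α n)) atTop (𝓝[>] 0) := by
    refine tendsto_nhdsWithin_iff.2 ⟨?_, ?_⟩
    · simpa using (tendsto_qdist_zero hr hq hsupp).const_mul b
    · filter_upwards [eventually_ge_atTop 1] with n hn using mul_pos hb (hDpos n hn)
  have hinv := (hlim.comp hDlim).inv
  refine le_of_tendsto hinv ?_
  filter_upwards [eventually_ge_atTop 1] with n hn
  rw [Function.comp_apply, ENNReal.inv_div (Or.inl measure_ball_lt_top.ne)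
    (Or.inl (measure_ball_pos _ _ (mul_pos hb (hDpos n hn))).ne')]
  exact le_iSup₂_of_le n hn le_rfl

end MaximalFunction

section Dilation

variable {d : ℕ}

lemma qdist_dilate_le {θ : ℝ} (hθ : 0 < θ) (μ x : EuclideanSpace ℝ (Fin d))
    {α : Finset (EuclideanSpace ℝ (Fin d))} (hα : α.Nonempty) :
    qdist x (dilate α θ μ) ≤ θ * qdist (μ + θ⁻¹ • (x - μ)) α := by
  obtain ⟨a, ha, he⟩ := exists_qdist_eq_dist (μ + θ⁻¹ • (x - μ)) hα
  refine (qdist_le_dist x (Finset.mem_image_of_mem (fun a => μ + θ • (a - μ)) ha)).trans_eq ?_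
  rw [he, dist_eq_norm, dist_eq_norm]
  nth_rewrite 2 [← abs_of_pos hθ]
  rw [← Real.norm_eq_abs, ← norm_smul]
  congr 1
  have h1 : θ • θ⁻¹ • (x - μ) = x - μ := smul_inv_smul₀ hθ.ne' _
  rw [smul_sub θ _ a, smul_add, h1, smul_sub]
  abel

lemma qerr_dilate_le {s θ : ℝ} (hs : 0 < s) (hθ : 0 < θ) (μ : EuclideanSpace ℝ (Fin d))
    (P : Measure (EuclideanSpace ℝ (Fin d))) {α : Finset (EuclideanSpace ℝ (Fin d))}
    (hα : α.Nonempty) :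
    qerr P s (dilate α θ μ) ≤ ENNReal.ofReal (θ ^ s) * qerr (Pdil P θ μ) s α := by
  have hm : Measurable fun y => ENNReal.ofReal (qdist y α) ^ s :=
    (measurable_qdist α).ennreal_ofReal.pow_const s
  have hT : Measurable fun x : EuclideanSpace ℝ (Fin d) => μ + θ⁻¹ • (x - μ) := by fun_prop
  rw [qerr, qerr, Pdil, lintegral_map hm hT, ← lintegral_const_mul' _ _ ENNReal.ofReal_ne_top]
  refine lintegral_mono fun x => ?_
  rw [← ENNReal.ofReal_rpow_of_nonneg hθ.le hs.le, ← ENNReal.mul_rpow_of_nonneg _ _ hs.le,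
    ← ENNReal.ofReal_mul hθ.le]
  gcongr
  exact qdist_dilate_le hθ μ x hα

lemma lintegral_fdil_mul {θ : ℝ} (hθ : 0 < θ) (μ : EuclideanSpace ℝ (Fin d))
    {f : EuclideanSpace ℝ (Fin d) → ℝ} (hfm : Measurable f)
    {P : Measure (EuclideanSpace ℝ (Fin d))}
    (hP : P = volume.withDensity fun x => ENNReal.ofReal (f x))
    {g : EuclideanSpace ℝ (Fin d) → ℝ≥0∞} (hg : Measurable g) :
    ∫⁻ x, ENNReal.ofReal (fdil f θ μ x) * g x =
      ENNReal.ofReal |(θ ^ d)⁻¹| * ∫⁻ x, g x ∂(Pdil P θ μ) := by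
  have hT : Measurable fun x : EuclideanSpace ℝ (Fin d) => μ + θ⁻¹ • (x - μ) := by fun_prop
  have hgT : Measurable fun x => g (μ + θ⁻¹ • (x - μ)) := hg.comp hT
  rw [Pdil, lintegral_map hg hT, hP,
    lintegral_withDensity_eq_lintegral_mul _ hfm.ennreal_ofReal hgT]
  set F : EuclideanSpace ℝ (Fin d) → ℝ≥0∞ :=
    (fun x => ENNReal.ofReal (f x)) * fun x => g (μ + θ⁻¹ • (x - μ)) with hF
  have hFm : Measurable F := hfm.ennreal_ofReal.mul hgT
  calc ∫⁻ x, ENNReal.ofReal (fdil f θ μ x) * g x = ∫⁻ x, F (μ + θ • (x - μ)) := by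
        refine lintegral_congr fun x => ?_
        simp only [hF, Pi.mul_apply, fdil, add_sub_cancel_left]
        rw [inv_smul_smul₀ hθ.ne', add_sub_cancel]
    _ = ∫⁻ x, F (μ + θ • x) := lintegral_sub_right_eq_self (fun x => F (μ + θ • x)) μ
    _ = ∫⁻ x, F (μ + x) ∂(Measure.map (fun x => θ • x) volume) := by
        rw [lintegral_map (f := fun x => F (μ + x)) (by fun_prop) (by fun_prop)]
    _ = ENNReal.ofReal |(θ ^ d)⁻¹| * ∫⁻ x, F (μ + x) := by
        rw [Measure.map_addHaar_smul _ hθ.ne', finrank_euclideanSpace_fin,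
          lintegral_smul_measure, smul_eq_mul]
    _ = _ := by rw [lintegral_add_left_eq_self F μ]

end Dilation

section RateOptimality

variable {d : ℕ}

lemma natCast_mul_rpow_neg_pow (hd : 1 ≤ d) {n : ℕ} (hn : 1 ≤ n) :
    (n : ℝ) * ((n : ℝ) ^ (-(1 / (d : ℝ)))) ^ d = 1 := by
  have hn0 : (0 : ℝ) < n := by exact_mod_cast hn
  have hd0 : (d : ℝ) ≠ 0 := by positivity
  rw [← Real.rpow_natCast, ← Real.rpow_mul hn0.le, neg_mul, one_div_mul_cancel hd0,
    Real.rpow_neg_one, mul_inv_cancel₀ hn0.ne']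

lemma tendsto_natCast_rpow_neg (hd : 1 ≤ d) :
    Tendsto (fun n : ℕ => (n : ℝ) ^ (-(1 / (d : ℝ)))) atTop (𝓝 0) :=
  (tendsto_rpow_neg_atTop (by positivity)).comp tendsto_natCast_atTop_atTop

lemma OptimalSeq.exists_mul_measure_ball_le (hd : 1 ≤ d) {r b : ℝ} (hr : 0 < r)
    (hb : b ∈ Ioo (0 : ℝ) (1 / 2)) {f : EuclideanSpace ℝ (Fin d) → ℝ}
    {P : Measure (EuclideanSpace ℝ (Fin d))} [IsProbabilityMeasure P]
    (hP : P = volume.withDensity fun x => ENNReal.ofReal (f x))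
    {α : ℕ → Finset (EuclideanSpace ℝ (Fin d))} (hα : OptimalSeq P r α) {C₀ : ℝ} (hC₀ : 0 < C₀)
    (hq : ∀ᶠ n : ℕ in atTop,
      qerr P r (α n) ≤ ENNReal.ofReal (C₀ * ((n : ℝ) ^ (-(1 / (d : ℝ)))) ^ r)) :
    ∃ C : ℝ, 0 < C ∧ ∀ᶠ n : ℕ in atTop, ∀ x,
      ENNReal.ofReal (((1 - b) ^ r - b ^ r) * qdist x (α n) ^ r) *
        P (ball x (b * qdist x (α n))) ≤
      ENNReal.ofReal (C * (((n : ℝ) ^ (-(1 / (d : ℝ)))) ^ d *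
        ((n : ℝ) ^ (-(1 / (d : ℝ)))) ^ r)) := by
  obtain ⟨R, hR, c, hc, h₀, hh₀, hnear⟩ := exists_card_near_mul_pow_ge hr hP hC₀
  obtain ⟨C, hC, hrem⟩ := exists_removal_le hd hr P hR hc hC₀
  refine ⟨C, hC, ?_⟩
  have hlim := tendsto_natCast_rpow_neg hd
  have hlimd : Tendsto (fun n : ℕ => ((n : ℝ) ^ (-(1 / (d : ℝ)))) ^ d) atTop (𝓝 0) := by
    simpa [show d ≠ 0 by omega] using hlim.pow d
  filter_upwards [hq, eventually_ge_atTop 1, hlim.eventually (gt_mem_nhds hh₀),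
    hlimd.eventually (gt_mem_nhds hc)] with n hqn hn hnh hnc x
  have hn0 : (0 : ℝ) < n := by exact_mod_cast hn
  have hpos : 0 < (n : ℝ) ^ (-(1 / (d : ℝ))) := Real.rpow_pos_of_pos hn0 _
  obtain ⟨hne, hcard, -⟩ := hα n hn
  have hcn := hnear _ hpos hnh.le (α n) hne hqn
  have h2 : 2 ≤ ((α n).filter fun a => ‖a‖ ≤ R).card := by
    by_contra! hlt
    have h1 : (((α n).filter fun a => ‖a‖ ≤ R).card : ℝ) ≤ 1 := by
      exact_mod_cast Nat.lt_succ_iff.1 hlt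
    have : (((α n).filter fun a => ‖a‖ ≤ R).card : ℝ) * ((n : ℝ) ^ (-(1 / (d : ℝ)))) ^ d ≤
      1 * ((n : ℝ) ^ (-(1 / (d : ℝ)))) ^ d := by gcongr
    linarith
  obtain ⟨a, ha, hae, hle⟩ := hrem _ hpos (α n) h2 hcn hqn
  exact (mul_measure_ball_le_of_optimal hr hb
    (fun S hS hScard => hα.qerr_le hr hn hS (hScard.trans hcard))
    (ne_top_of_le_ne_top ENNReal.ofReal_ne_top hqn) ha hae x).trans hle

end RateOptimality

/-- **Theorem 3.2, upper estimate, `s > r`.**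
Let `s > r`, `θ > 0`, `μ ∈ ℝ^d`, `P = f·λ_d` with `E|X|^{r+η} < ∞` and
`P_{θ,μ} ≪ P`.  If `(α_n)` is `L^r(P)`-optimal and `ψ_b^{s/(d+r)} ∈ L¹(P_{θ,μ})`
for some `b ∈ (0,1/2)`, then `∫ f_{θ,μ} f^{-s/(d+r)} dλ_d < ∞` and
`limsup_n n^{s/d} ∫ d(x,α_n^{θ,μ})^s dP < ∞`. -/
theorem stmt_2 {d : ℕ} (hd : 1 ≤ d) (r s : ℝ) (hr : 0 < r) (hs : 0 < s) (hrs : r < s)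
    (θ : ℝ) (hθ : 0 < θ) (μ : EuclideanSpace ℝ (Fin d))
    (f : EuclideanSpace ℝ (Fin d) → ℝ) (hf0 : ∀ x, 0 ≤ f x) (hfm : Measurable f)
    (P : Measure (EuclideanSpace ℝ (Fin d))) [IsProbabilityMeasure P]
    (hP : P = volume.withDensity fun x => ENNReal.ofReal (f x))
    (η : ℝ) (hη : 0 < η)
    (hmom : (∫⁻ x, ENNReal.ofReal ‖x‖ ^ (r + η) ∂P) ≠ ⊤)
    (habs : Pdil P θ μ ≪ P)
    (α : ℕ → Finset (EuclideanSpace ℝ (Fin d))) (hα : OptimalSeq P r α)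
    (b : ℝ) (hb : b ∈ Ioo (0 : ℝ) (1 / 2))
    (hψ : (∫⁻ x, maxFun P α b x ^ (s / ((d : ℝ) + r)) ∂(Pdil P θ μ)) < ⊤) :
    (∫⁻ x, ENNReal.ofReal (fdil f θ μ x) *
        ENNReal.ofReal (f x) ^ (-(s / ((d : ℝ) + r)))) < ⊤ ∧
    RateOptimal P s (fun n => dilate (α n) θ μ) := by
  have hdr : 0 < (d : ℝ) + r := by positivity
  have hp : 0 < s / ((d : ℝ) + r) := by positivity
  obtain ⟨C₀, hC₀, hquant⟩ := exists_quantizer_qerr_le hd hr hη P hmom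
  have hq : ∀ᶠ n : ℕ in atTop,
      qerr P r (α n) ≤ ENNReal.ofReal (C₀ * ((n : ℝ) ^ (-(1 / (d : ℝ)))) ^ r) := by
    filter_upwards [eventually_ge_atTop 2] with n hn
    have hn0 : (0 : ℝ) < n := by positivity
    obtain ⟨S, hS, hScard, hSq⟩ := hquant n hn _ (Real.rpow_pos_of_pos hn0 (-(1 / (d : ℝ))))
      (natCast_mul_rpow_neg_pow hd (by omega))
    exact (hα.qerr_le hr (by omega) hS hScard).trans hSq
  constructor
  · have hq0 : Tendsto (fun n => qerr P r (α n)) atTop (𝓝 0) := by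
      refine tendsto_of_tendsto_of_tendsto_of_le_of_le' tendsto_const_nhds ?_
        (Eventually.of_forall fun _ => zero_le) hq
      have := ((tendsto_natCast_rpow_neg hd).rpow_const (Or.inr hr.le)).const_mul C₀
      rw [Real.zero_rpow hr.ne', mul_zero] at this
      simpa using ENNReal.tendsto_ofReal this
    have hae := habs.ae_le
      (ae_inv_density_le_maxFun hd hr hb.1 hfm hP (fun n hn => (hα n hn).1) hq0)
    rw [lintegral_fdil_mul hθ μ hfm hP (hfm.ennreal_ofReal.pow_const _)]
    refine ENNReal.mul_lt_top ENNReal.ofReal_lt_top (lt_of_le_of_lt ?_ hψ)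
    refine lintegral_mono_ae ?_
    filter_upwards [hae] with x hx
    rw [ENNReal.rpow_neg, ← ENNReal.inv_rpow]
    exact ENNReal.rpow_le_rpow hx hp.le
  · obtain ⟨C, hC, hball⟩ := hα.exists_mul_measure_ball_le hd hr hb hP hC₀ hq
    have hc : 0 < (1 - b) ^ r - b ^ r :=
      sub_pos.2 (Real.rpow_lt_rpow hb.1.le (by linarith [hb.2]) hr)
    set K := (C / (((1 - b) ^ r - b ^ r) * ballVol d * b ^ d)) ^ (s / ((d : ℝ) + r)) with hK
    have hK0 : 0 ≤ K := by
      have := ballVol_pos d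
      have := hb.1
      positivity
    set I := ∫⁻ x, maxFun P α b x ^ (s / ((d : ℝ) + r)) ∂(Pdil P θ μ) with hI
    refine lt_of_le_of_lt (limsup_le_of_le (a := ENNReal.ofReal (θ ^ s * K) * I)
      (by isBoundedDefault) ?_) (ENNReal.mul_lt_top ENNReal.ofReal_lt_top hψ)
    filter_upwards [hball, eventually_ge_atTop 1] with n hn hn1
    have hn0 : (0 : ℝ) < n := by exact_mod_cast hn1
    set h := (n : ℝ) ^ (-(1 / (d : ℝ))) with hh
    have hpos : 0 < h := Real.rpow_pos_of_pos hn0 _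
    have hqs : qerr (Pdil P θ μ) s (α n) ≤ ENNReal.ofReal (K * h ^ s) * I := by
      rw [hI, ← lintegral_const_mul' _ _ ENNReal.ofReal_ne_top]
      exact lintegral_mono fun x =>
        ofReal_qdist_rpow_le_maxFun hd hr hs hb.1 hc hC hpos hn1 x (hn x)
    calc (n : ℝ≥0∞) ^ (s / (d : ℝ)) * qerr P s (dilate (α n) θ μ)
        ≤ ENNReal.ofReal ((n : ℝ) ^ (s / (d : ℝ))) *
            (ENNReal.ofReal (θ ^ s) * (ENNReal.ofReal (K * h ^ s) * I)) := by
          rw [← ENNReal.ofReal_rpow_of_pos hn0, ENNReal.ofReal_natCast]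
          gcongr
          exact (qerr_dilate_le hs hθ μ P (hα n hn1).1).trans (by gcongr)
      _ = ENNReal.ofReal (θ ^ s * K) * I := by
          rw [← mul_assoc, ← mul_assoc, ← ENNReal.ofReal_mul (by positivity),
            ← ENNReal.ofReal_mul (by positivity)]
          congr 2
          have e : (n : ℝ) ^ (s / (d : ℝ)) * h ^ s = 1 := by
            rw [hh, ← Real.rpow_mul hn0.le, ← Real.rpow_add hn0]
            convert Real.rpow_zero _ using 2
            ring
          linear_combination (θ ^ s * K) * e
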